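/- If X is a nonempty path-connected topological space whose fundamental group π₁(X) is not a perfect group (i.e., π₁(X) is not equal to its own commutator subgroup), then the second homotopy group π₂(ΣX) of the unreduced suspension of X is nontrivial. -/

import Mathlib

open CategoryTheory unitInterval

/-- The gluing relation for the unreduced suspension: collapse `X × {0}` to a point
and `X × {1}` to a point. -/
def suspSetoid (X : Type) [TopologicalSpace X] : Setoid (X × unitInterval) where
  r p q := p = q ∨ (p.2 = 0 ∧ q.2 = 0) ∨ (p.2 = 1 ∧ q.2 = 1)
  iseqv := by
    refine ⟨fun _ => Or.inl rfl, ?_, ?_⟩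
    · rintro p q (rfl | ⟨h1, h2⟩ | ⟨h1, h2⟩)
      exacts [Or.inl rfl, Or.inr (Or.inl ⟨h2, h1⟩), Or.inr (Or.inr ⟨h2, h1⟩)]
    · have zno : (0 : unitInterval) ≠ 1 := fun h => by
        simpa using congrArg Subtype.val h
      rintro p q r (rfl | ⟨h1, h2⟩ | ⟨h1, h2⟩) (rfl | ⟨g1, g2⟩ | ⟨g1, g2⟩)
      · exact Or.inl rfl
      · exact Or.inr (Or.inl ⟨g1, g2⟩)
      · exact Or.inr (Or.inr ⟨g1, g2⟩)
      · exact Or.inr (Or.inl ⟨h1, h2⟩)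
      · exact Or.inr (Or.inl ⟨h1, g2⟩)
      · exact absurd (h2.symm.trans g1) zno
      · exact Or.inr (Or.inr ⟨h1, h2⟩)
      · exact absurd (g1.symm.trans h2) zno
      · exact Or.inr (Or.inr ⟨h1, g2⟩)

/-- The unreduced suspension `ΣX` of a topological space `X`: the quotient of
`X × [0,1]` collapsing `X × {0}` to one point and `X × {1}` to another. -/
def UnreducedSuspension (X : Type) [TopologicalSpace X] : Type :=
  Quotient (suspSetoid X)

instance (X : Type) [TopologicalSpace X] : TopologicalSpace (UnreducedSuspension X) :=
  instTopologicalSpaceQuotient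

/-- The singular chain complex of a topological space, with `ℤ` coefficients. -/
noncomputable def singularChainComplex (X : Type) [TopologicalSpace X] :
    ChainComplex (ModuleCat ℤ) ℕ :=
  (AlgebraicTopology.alternatingFaceMapComplex (ModuleCat ℤ)).obj
    (((SimplicialObject.whiskering _ _).obj (ModuleCat.free ℤ)).obj
      (TopCat.toSSet.obj (TopCat.of X)))

/-- The `n`-th singular homology of a topological space, with `ℤ` coefficients. -/
noncomputable def singularHomology (X : Type) [TopologicalSpace X] (n : ℕ) : ModuleCat ℤ :=
  (singularChainComplex X).homology n


noncomputable section

namespace SuspPi2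

open Set

set_option linter.unusedSectionVars false

variable {X : Type} [TopologicalSpace X]

/-- the quotient map -/
def qm (a : X) (t : I) : UnreducedSuspension X := Quotient.mk (suspSetoid X) (a, t)

lemma continuous_qm : Continuous (fun z : X × I => qm z.1 z.2) :=
  continuous_quotient_mk'

/-- height -/
def ht : UnreducedSuspension X → I :=
  Quotient.lift Prod.snd (by
    rintro a b (rfl | ⟨h1, h2⟩ | ⟨h1, h2⟩)
    · rfl
    · rw [h1, h2]
    · rw [h1, h2])

lemma continuous_ht : Continuous (ht : UnreducedSuspension X → I) :=
  continuous_snd.quotient_lift _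

@[simp] lemma ht_qm (a : X) (t : I) : ht (qm a t) = t := rfl

/-- projection to the base (meaningful off the poles) -/
def pr (z : UnreducedSuspension X) : X := (Quotient.out z).1

/-- complement of the poles -/
def W : Set (UnreducedSuspension X) := {z | ht z ≠ 0 ∧ ht z ≠ 1}

lemma qm_zero (a b : X) : qm a 0 = qm b 0 :=
  Quotient.sound (Or.inr (Or.inl ⟨rfl, rfl⟩))

lemma qm_one (a b : X) : qm a 1 = qm b 1 :=
  Quotient.sound (Or.inr (Or.inr ⟨rfl, rfl⟩))

lemma pr_qm (a : X) (t : I) (h0 : t ≠ 0) (h1 : t ≠ 1) : pr (qm a t) = a := by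
  have h : (suspSetoid X).r (Quotient.out (qm a t)) (a, t) := Quotient.mk_out (a, t)
  rcases h with h | ⟨_, h⟩ | ⟨_, h⟩
  · exact congrArg Prod.fst h
  · exact absurd h h0
  · exact absurd h h1

lemma isOpen_W : IsOpen (W : Set (UnreducedSuspension X)) := by
  have : (W : Set (UnreducedSuspension X)) = ht ⁻¹' ({0}ᶜ ∩ {1}ᶜ) := rfl
  rw [this]
  exact (isOpen_compl_singleton.inter isOpen_compl_singleton).preimage continuous_ht

lemma continuousOn_pr : ContinuousOn (pr : UnreducedSuspension X → X) W := by
  rw [continuousOn_open_iff isOpen_W]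
  intro O hO
  have key : IsOpen ((fun z : X × I => qm z.1 z.2) ⁻¹' (W ∩ pr ⁻¹' O)) := by
    have : ((fun z : X × I => qm z.1 z.2) ⁻¹' (W ∩ pr ⁻¹' O)) = O ×ˢ ({0}ᶜ ∩ {1}ᶜ) := by
      ext ⟨a, t⟩
      constructor
      · rintro ⟨⟨h0, h1⟩, h2⟩
        have h2' : pr (qm a t) ∈ O := h2
        rw [pr_qm a t h0 h1] at h2'
        exact ⟨h2', h0, h1⟩
      · rintro ⟨h2, h0, h1⟩
        refine ⟨⟨h0, h1⟩, ?_⟩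
        change pr (qm a t) ∈ O
        rw [pr_qm a t h0 h1]; exact h2
    rw [this]
    exact hO.prod (isOpen_compl_singleton.inter isOpen_compl_singleton)
  exact key

/-- An additive, homotopy invariant function of paths. -/
structure PathFun (X : Type) [TopologicalSpace X] (A : Type) [AddCommGroup A] where
  Φ : C(I, X) → A
  trans : ∀ {a b c : X} (p : Path a b) (q : Path b c),
    Φ (p.trans q).toContinuousMap = Φ p.toContinuousMap + Φ q.toContinuousMap
  hom : ∀ {a b : X} (p q : Path a b), p.Homotopic q → Φ p.toContinuousMap = Φ q.toContinuousMap

variable {A : Type} [AddCommGroup A]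

lemma PathFun.const (F : PathFun X A) (a : X) : F.Φ (ContinuousMap.const I a) = 0 := by
  have h := F.trans (Path.refl a) (Path.refl a)
  rw [Path.refl_trans_refl] at h
  exact left_eq_add.mp h

lemma exists_pathFun [PathConnectedSpace X] (x : X) (hx : commutator (FundamentalGroup X x) ≠ ⊤)
    (x0 : X) : ∃ (A : Type) (_ : AddCommGroup A) (F : PathFun X A) (γ : Path x0 x0),
      F.Φ γ.toContinuousMap ≠ 0 := by
  let c : ∀ z, Path x z := fun z => PathConnectedSpace.somePath x z
  let φ : ∀ {a b : X}, Path a b → Additive (Abelianization (FundamentalGroup X x)) :=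
    fun {a b} p => Additive.ofMul (Abelianization.of (FundamentalGroup.fromPath
      (Path.Homotopic.Quotient.mk (((c a).trans p).trans (c b).symm))))
  let Φ : C(I, X) → Additive (Abelianization (FundamentalGroup X x)) :=
    fun e => φ (⟨e, rfl, rfl⟩ : Path (e 0) (e 1))
  have hΦ : ∀ {a b : X} (p : Path a b), Φ p.toContinuousMap = φ p := by
    rintro a b ⟨e, h0, h1⟩
    subst h0
    subst h1
    rfl
  have φtrans : ∀ {a b d : X} (p : Path a b) (q : Path b d), φ (p.trans q) = φ p + φ q := by
    intro a b d p q
    rw [add_comm]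
    simp only [φ]
    rw [← ofMul_mul, ← map_mul]
    congr 2
    simp only [FundamentalGroup.mul_def, FundamentalGroup.fromPath, FundamentalGroup.fromArrow,
      Path.Homotopic.Quotient.mk_trans, Path.Homotopic.Quotient.mk_symm]
    simp only [Path.Homotopic.Quotient.trans_assoc]
    congr 2
    rw [← Path.Homotopic.Quotient.trans_assoc, Path.Homotopic.Quotient.symm_trans,
      Path.Homotopic.Quotient.refl_trans]
  let F : PathFun X (Additive (Abelianization (FundamentalGroup X x))) :=
    { Φ := Φ
      trans := by
        intro a b d p q
        rw [hΦ, hΦ, hΦ, φtrans]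
      hom := by
        intro a b p q h
        rw [hΦ, hΦ]
        simp only [φ]
        congr 3
        simp only [Path.Homotopic.Quotient.mk_trans, Path.Homotopic.Quotient.mk_symm]
        rw [Path.Homotopic.Quotient.eq.mpr h] }
  obtain ⟨g, hg⟩ : ∃ g, g ∉ commutator (FundamentalGroup X x) := by
    by_contra! h
    exact hx (eq_top_iff.mpr fun g _ => h g)
  obtain ⟨δ, hδ⟩ := Path.Homotopic.Quotient.mk_surjective (FundamentalGroup.toPath g)
  have hsymm : ∀ {a b : X} (p : Path a b), φ p.symm = - φ p := by
    intro a b p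
    have h1 : φ (p.symm.trans p) = φ (Path.refl b) := by
      simp only [φ]
      congr 3
      simp
    have h2 : φ (Path.refl b) = 0 := by
      have := φtrans (Path.refl b) (Path.refl b)
      rw [Path.refl_trans_refl] at this
      exact left_eq_add.mp this
    rw [φtrans, h2] at h1
    exact eq_neg_of_add_eq_zero_left h1
  have hδ0 : φ δ = Additive.ofMul (Abelianization.of g) := by
    let k : FundamentalGroup X x := FundamentalGroup.fromPath (Path.Homotopic.Quotient.mk (c x))
    have : φ δ = Additive.ofMul (Abelianization.of (k⁻¹ * (g * k))) := by
      simp only [φ, Path.Homotopic.Quotient.mk_trans, Path.Homotopic.Quotient.mk_symm, hδ]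
      rfl
    rw [this]
    congr 1
    rw [map_mul, map_mul, map_inv]
    rw [mul_comm, mul_assoc, mul_inv_cancel, mul_one]
  refine ⟨_, inferInstance, F, ((c x0).symm.trans δ).trans (c x0), ?_⟩
  change Φ _ ≠ 0
  rw [hΦ, φtrans, φtrans, hsymm, hδ0]
  intro h
  apply hg
  rw [neg_add_cancel_comm] at h
  have h' : Abelianization.of g = 1 := h
  rw [← Abelianization.ker_of]
  exact h'

/-! ### the cochains -/
variable {E : Type} [AddCommGroup E] [Module ℝ E] [TopologicalSpace E] [IsTopologicalAddGroup E]
  [ContinuousSMul ℝ E]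

open Classical in
/-- 1-cochain -/
def psi (F : PathFun X A) (G : C(E, UnreducedSuspension X)) (a b : E) : A :=
  if h : Continuous (fun t : I => pr (G (AffineMap.lineMap a b (t : ℝ)))) ∧
      ∀ t : I, G (AffineMap.lineMap a b (t : ℝ)) ∈ W then
    F.Φ ⟨fun t : I => pr (G (AffineMap.lineMap a b (t : ℝ))), h.1⟩ else 0

/-- straight path in a convex set -/
def seg {S : Set E} (hS : Convex ℝ S) {a b : E} (ha : a ∈ S) (hb : b ∈ S) :
    Path (⟨a, ha⟩ : S) ⟨b, hb⟩ where
  toFun t := ⟨AffineMap.lineMap a b (t : ℝ), hS.lineMap_mem ha hb t.2⟩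
  continuous_toFun := by
    refine Continuous.subtype_mk ?_ _
    simp only [AffineMap.lineMap_apply_module]
    fun_prop
  source' := by simp
  target' := by simp

lemma psi_add (F : PathFun X A) (G : C(E, UnreducedSuspension X)) {S : Set E} (hS : Convex ℝ S)
    (hW : ∀ z ∈ S, G z ∈ W) {a b c : E} (ha : a ∈ S) (hb : b ∈ S) (hc : c ∈ S) :
    psi F G a b + psi F G b c = psi F G a c := by
  let g : C(S, X) := ⟨fun z => pr (G z), by
    exact continuousOn_pr.comp_continuous (G.continuous.comp continuous_subtype_val)
      (fun z => hW z z.2)⟩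
  have key : ∀ {a b : E} (ha : a ∈ S) (hb : b ∈ S),
      psi F G a b = F.Φ ((seg hS ha hb).map g.continuous).toContinuousMap := by
    intro a b ha hb
    have h : Continuous (fun t : I => pr (G (AffineMap.lineMap a b (t : ℝ)))) ∧
      ∀ t : I, G (AffineMap.lineMap a b (t : ℝ)) ∈ W :=
      ⟨((seg hS ha hb).map g.continuous).continuous, fun t => hW _ (hS.lineMap_mem ha hb t.2)⟩
    rw [psi, dif_pos h]
    rfl
  have : ContractibleSpace S := hS.contractibleSpace ⟨a, ha⟩
  rw [key ha hb, key hb hc, key ha hc, ← F.trans, ← Path.map_trans]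
  apply F.hom
  exact (SimplyConnectedSpace.paths_homotopic _ _).map g

lemma psi_zero (F : PathFun X A) (G : C(E, UnreducedSuspension X)) {S : Set E} (hS : Convex ℝ S)
    (x0 : X) (h0 : ∀ z ∈ S, ∃ w, G z = qm x0 w) {a b : E} (ha : a ∈ S) (hb : b ∈ S) :
    psi F G a b = 0 := by
  unfold psi
  split_ifs with h
  · rw [← F.const x0]
    congr 1
    ext t
    obtain ⟨w, hw⟩ := h0 _ (hS.lineMap_mem ha hb t.2)
    have := h.2 t
    simp only [ContinuousMap.coe_mk, ContinuousMap.const_apply]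
    rw [hw] at this ⊢
    exact pr_qm _ _ this.1 this.2
  · rfl

/-- circulation -/
def circ (F : PathFun X A) (G : C(E, UnreducedSuspension X)) (a b d e : E) : A :=
  psi F G a b + psi F G b e - psi F G a d - psi F G d e

open Classical in
/-- 2-cochain -/
def cc (F : PathFun X A) (G : C(E, UnreducedSuspension X)) (a b d e : E) : A :=
  if ∀ z ∈ convexHull ℝ ({a, b, d, e} : Set E), ht (G z) ≠ 1 then 0 else circ F G a b d e

lemma hull_sub {S : Set E} (hS : Convex ℝ S) {a b d e : E}
    (ha : a ∈ S) (hb : b ∈ S) (hd : d ∈ S) (he : e ∈ S) :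
    convexHull ℝ ({a, b, d, e} : Set E) ⊆ S := by
  apply convexHull_min _ hS
  rintro z (rfl | rfl | rfl | rfl) <;> assumption

lemma cc_U (F : PathFun X A) (G : C(E, UnreducedSuspension X)) {S : Set E} (hS : Convex ℝ S)
    (h : ∀ z ∈ S, ht (G z) ≠ 1) {a b d e : E}
    (ha : a ∈ S) (hb : b ∈ S) (hd : d ∈ S) (he : e ∈ S) : cc F G a b d e = 0 :=
  if_pos fun z hz => h z (hull_sub hS ha hb hd he hz)

lemma cc_V (F : PathFun X A) (G : C(E, UnreducedSuspension X)) {S : Set E} (hS : Convex ℝ S)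
    (h : ∀ z ∈ S, ht (G z) ≠ 0) {a b d e : E}
    (ha : a ∈ S) (hb : b ∈ S) (hd : d ∈ S) (he : e ∈ S) :
    cc F G a b d e = circ F G a b d e := by
  unfold cc
  split_ifs with h1
  · have hT := convex_convexHull ℝ ({a, b, d, e} : Set E)
    have hsub := subset_convexHull ℝ ({a, b, d, e} : Set E)
    have hW : ∀ z ∈ convexHull ℝ ({a, b, d, e} : Set E), G z ∈ W :=
      fun z hz => ⟨h z (hull_sub hS ha hb hd he hz), h1 z hz⟩
    have e1 := psi_add F G hT hW (hsub (by simp : a ∈ _)) (hsub (by simp : b ∈ _))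
      (hsub (by simp : e ∈ _))
    have e2 := psi_add F G hT hW (hsub (by simp : a ∈ _)) (hsub (by simp : d ∈ _))
      (hsub (by simp : e ∈ _))
    rw [circ, e1, ← e2]
    abel
  · rfl

lemma circ_zero (F : PathFun X A) (G : C(E, UnreducedSuspension X)) {S : Set E}
    (hS : Convex ℝ S) (x0 : X) (h0 : ∀ z ∈ S, ∃ w, G z = qm x0 w) {a b d e : E}
    (ha : a ∈ S) (hb : b ∈ S) (hd : d ∈ S) (he : e ∈ S) : circ F G a b d e = 0 := by
  rw [circ, psi_zero F G hS x0 h0 ha hb, psi_zero F G hS x0 h0 hb he,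
    psi_zero F G hS x0 h0 ha hd, psi_zero F G hS x0 h0 hd he]
  simp

lemma cc_zero (F : PathFun X A) (G : C(E, UnreducedSuspension X)) {S : Set E}
    (hS : Convex ℝ S) (x0 : X) (h0 : ∀ z ∈ S, ∃ w, G z = qm x0 w) {a b d e : E}
    (ha : a ∈ S) (hb : b ∈ S) (hd : d ∈ S) (he : e ∈ S) : cc F G a b d e = 0 := by
  unfold cc
  rw [circ_zero F G hS x0 h0 ha hb hd he, ite_self]

lemma cc_cocycle (F : PathFun X A) (G : C(E, UnreducedSuspension X)) {S : Set E}
    (hS : Convex ℝ S) (h : (∀ z ∈ S, ht (G z) ≠ 1) ∨ (∀ z ∈ S, ht (G z) ≠ 0))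
    {p000 p100 p010 p110 p001 p101 p011 p111 : E}
    (h000 : p000 ∈ S) (h100 : p100 ∈ S) (h010 : p010 ∈ S) (h110 : p110 ∈ S)
    (h001 : p001 ∈ S) (h101 : p101 ∈ S) (h011 : p011 ∈ S) (h111 : p111 ∈ S) :
    (cc F G p001 p101 p011 p111 - cc F G p000 p100 p010 p110)
    - (cc F G p010 p110 p011 p111 - cc F G p000 p100 p001 p101)
    + (cc F G p100 p110 p101 p111 - cc F G p000 p010 p001 p011) = 0 := by
  rcases h with h | h
  · rw [cc_U F G hS h h001 h101 h011 h111, cc_U F G hS h h000 h100 h010 h110,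
      cc_U F G hS h h010 h110 h011 h111, cc_U F G hS h h000 h100 h001 h101,
      cc_U F G hS h h100 h110 h101 h111, cc_U F G hS h h000 h010 h001 h011]
    simp
  · rw [cc_V F G hS h h001 h101 h011 h111, cc_V F G hS h h000 h100 h010 h110,
      cc_V F G hS h h010 h110 h011 h111, cc_V F G hS h h000 h100 h001 h101,
      cc_V F G hS h h100 h110 h101 h111, cc_V F G hS h h000 h010 h001 h011]
    simp only [circ]
    abel

lemma telescope (N : ℕ) (c12 c13 c23 : ℕ → ℕ → ℕ → A)
    (h : ∀ i < N, ∀ j < N, ∀ k < N, (c12 i j (k + 1) - c12 i j k) - (c13 i (j + 1) k - c13 i j k)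
      + (c23 (i + 1) j k - c23 i j k) = 0)
    (h12 : ∀ i < N, ∀ j < N, c12 i j N = 0)
    (h13 : ∀ i < N, ∀ k < N, c13 i 0 k = 0) (h13' : ∀ i < N, ∀ k < N, c13 i N k = 0)
    (h23 : ∀ j < N, ∀ k < N, c23 0 j k = 0) (h23' : ∀ j < N, ∀ k < N, c23 N j k = 0) :
    ∑ i ∈ Finset.range N, ∑ j ∈ Finset.range N, c12 i j 0 = 0 := by
  have e1 : ∑ i ∈ Finset.range N, ∑ j ∈ Finset.range N, ∑ k ∈ Finset.range N,
      (c12 i j (k + 1) - c12 i j k) = - ∑ i ∈ Finset.range N, ∑ j ∈ Finset.range N, c12 i j 0 := by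
    rw [← Finset.sum_neg_distrib]
    refine Finset.sum_congr rfl fun i hi => ?_
    rw [← Finset.sum_neg_distrib]
    refine Finset.sum_congr rfl fun j hj => ?_
    rw [Finset.sum_range_sub, h12 i (Finset.mem_range.mp hi) j (Finset.mem_range.mp hj), zero_sub]
  have e2 : ∑ i ∈ Finset.range N, ∑ j ∈ Finset.range N, ∑ k ∈ Finset.range N,
      (c13 i (j + 1) k - c13 i j k) = 0 := by
    refine Finset.sum_eq_zero fun i hi => ?_
    rw [Finset.sum_comm]
    refine Finset.sum_eq_zero fun k hk => ?_
    rw [Finset.sum_range_sub (fun j => c13 i j k), h13 i (Finset.mem_range.mp hi) k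
      (Finset.mem_range.mp hk), h13' i (Finset.mem_range.mp hi) k (Finset.mem_range.mp hk), sub_zero]
  have e3 : ∑ i ∈ Finset.range N, ∑ j ∈ Finset.range N, ∑ k ∈ Finset.range N,
      (c23 (i + 1) j k - c23 i j k) = 0 := by
    rw [Finset.sum_comm]
    refine Finset.sum_eq_zero fun j hj => ?_
    rw [Finset.sum_comm]
    refine Finset.sum_eq_zero fun k hk => ?_
    rw [Finset.sum_range_sub (fun i => c23 i j k), h23 j (Finset.mem_range.mp hj) k
      (Finset.mem_range.mp hk), h23' j (Finset.mem_range.mp hj) k (Finset.mem_range.mp hk), sub_zero]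
  have e0 : ∑ i ∈ Finset.range N, ∑ j ∈ Finset.range N, ∑ k ∈ Finset.range N,
      ((c12 i j (k + 1) - c12 i j k) - (c13 i (j + 1) k - c13 i j k)
      + (c23 (i + 1) j k - c23 i j k)) = 0 :=
    Finset.sum_eq_zero fun i hi => Finset.sum_eq_zero fun j hj => Finset.sum_eq_zero fun k hk =>
      h i (Finset.mem_range.mp hi) j (Finset.mem_range.mp hj) k (Finset.mem_range.mp hk)
  simp only [Finset.sum_add_distrib, Finset.sum_sub_distrib] at e0 e1 e2 e3
  rw [e1, e2, e3] at e0
  simpa using e0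


/-! ### The representing map -/

/-- collar distance -/
def dd (s t : ℝ) : ℝ := max 0 (min 1 (4 * max |s - 1/2| |t - 1/2| - 1))

/-- height coordinate -/
def vv (t0 : I) (s t : ℝ) : I :=
  projIcc 0 1 zero_le_one ((1 - dd s t) * (projIcc (0:ℝ) 1 zero_le_one (2 * t - 1/2) : ℝ)
    + dd s t * (t0 : ℝ))

lemma continuous_vv (t0 : I) : Continuous (fun w : ℝ × ℝ => vv t0 w.1 w.2) := by
  unfold vv dd
  have h : Continuous (projIcc (0:ℝ) 1 zero_le_one) := continuous_projIcc
  fun_prop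

/-- the map -/
def ff {x0 : X} (γ : Path x0 x0) (t0 : I) (w : ℝ × ℝ) : UnreducedSuspension X :=
  if |w.2 - 1/2| ≤ 1/4 then qm (γ (projIcc 0 1 zero_le_one (2 * w.1 - 1/2))) (vv t0 w.1 w.2)
  else qm x0 (vv t0 w.1 w.2)

lemma dd_zero {s t : ℝ} (hs : |s - 1/2| ≤ 1/4) (ht : |t - 1/2| ≤ 1/4) : dd s t = 0 := by
  unfold dd
  have : max |s - 1/2| |t - 1/2| ≤ 1/4 := max_le hs ht
  apply max_eq_left
  apply min_le_of_right_le
  linarith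

lemma gam_outer {x0 : X} (γ : Path x0 x0) {s : ℝ} (hs : s ≤ 1/4 ∨ 3/4 ≤ s) :
    γ (projIcc 0 1 zero_le_one (2 * s - 1/2)) = x0 := by
  rcases hs with hs | hs
  · rw [projIcc_of_le_left zero_le_one (by linarith)]
    exact γ.source
  · rw [projIcc_of_right_le zero_le_one (by linarith)]
    exact γ.target

lemma vv_inner (t0 : I) {s t : ℝ} (hs : |s - 1/2| ≤ 1/4) (ht : |t - 1/2| ≤ 1/4) :
    vv t0 s t = projIcc 0 1 zero_le_one (2 * t - 1/2) := by
  unfold vv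
  rw [dd_zero hs ht]
  simp

lemma edge_eq {x0 : X} (γ : Path x0 x0) (t0 : I) {s t : ℝ} (ht : |t - 1/2| = 1/4) :
    qm (γ (projIcc 0 1 zero_le_one (2 * s - 1/2))) (vv t0 s t) = qm x0 (vv t0 s t) := by
  by_cases hs : |s - 1/2| ≤ 1/4
  · rw [vv_inner t0 hs ht.le]
    rcases eq_or_eq_neg_of_abs_eq ht with h | h
    · rw [projIcc_of_right_le zero_le_one (x := 2 * t - 1/2) (by linarith)]
      exact qm_one _ _
    · rw [projIcc_of_le_left zero_le_one (x := 2 * t - 1/2) (by linarith)]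
      exact qm_zero _ _
  · rw [gam_outer]
    by_contra! h
    exact hs (abs_le.mpr ⟨by linarith, by linarith⟩)

lemma continuous_ff {x0 : X} (γ : Path x0 x0) (t0 : I) : Continuous (ff γ t0) := by
  unfold ff
  have h : Continuous (projIcc (0:ℝ) 1 zero_le_one) := continuous_projIcc
  refine Continuous.if_le ?_ ?_ (by fun_prop) continuous_const ?_
  · exact continuous_qm.comp (Continuous.prodMk (by fun_prop) (continuous_vv t0))
  · exact continuous_qm.comp (Continuous.prodMk (by fun_prop) (continuous_vv t0))
  · intro w hw
    exact edge_eq γ t0 hw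

lemma ff_outer {x0 : X} (γ : Path x0 x0) (t0 : I) {s t : ℝ}
    (h : s ≤ 1/4 ∨ 3/4 ≤ s ∨ t ≤ 1/4 ∨ 3/4 ≤ t) : ff γ t0 (s, t) = qm x0 (vv t0 s t) := by
  unfold ff
  split_ifs with h1
  · simp only at h1 ⊢
    by_cases hs : s ≤ 1/4 ∨ 3/4 ≤ s
    · rw [gam_outer γ hs]
    · apply edge_eq
      apply le_antisymm h1
      rw [← or_assoc] at h
      rcases h.resolve_left hs with h | h
      · rw [le_abs]; right; linarith
      · rw [le_abs]; left; linarith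
  · rfl

lemma ff_inner {x0 : X} (γ : Path x0 x0) (t0 : I) {s t : ℝ}
    (hs : 1/4 ≤ s) (hs' : s ≤ 3/4) (ht : 1/4 ≤ t) (ht' : t ≤ 3/4) :
    ff γ t0 (s, t) = qm (γ (projIcc 0 1 zero_le_one (2 * s - 1/2)))
      (projIcc 0 1 zero_le_one (2 * t - 1/2)) := by
  have h1 : |s - 1/2| ≤ 1/4 := abs_le.mpr ⟨by linarith, by linarith⟩
  have h2 : |t - 1/2| ≤ 1/4 := abs_le.mpr ⟨by linarith, by linarith⟩
  unfold ff
  rw [if_pos h2, vv_inner t0 h1 h2]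

lemma ff_boundary {x0 : X} (γ : Path x0 x0) (t0 : I) {s t : ℝ}
    (h : s = 0 ∨ s = 1 ∨ t = 0 ∨ t = 1) : ff γ t0 (s, t) = qm x0 t0 := by
  rw [ff_outer]
  · congr 1
    have hd : dd s t = 1 := by
      unfold dd
      have : 1/2 ≤ max |s - 1/2| |t - 1/2| := by
        rw [le_max_iff, le_abs, le_abs]
        rcases h with h | h | h | h <;> subst h <;> norm_num
      rw [min_eq_left (by linarith)]
      norm_num
    unfold vv
    rw [hd]
    simp
  · rcases h with h | h | h | h <;> subst h <;> norm_num

/-- the representing generalized loop -/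
def gl {x0 : X} (γ : Path x0 x0) (t0 : I) : GenLoop (Fin 2) (UnreducedSuspension X) (qm x0 t0) :=
  ⟨⟨fun z => ff γ t0 ((z 0 : ℝ), (z 1 : ℝ)), (continuous_ff γ t0).comp (by fun_prop)⟩, by
    rintro z ⟨i, hi⟩
    apply ff_boundary
    fin_cases i
    · rcases hi with hi | hi
      · left; simpa using hi
      · right; left; simpa using hi
    · rcases hi with hi | hi
      · right; right; left; simpa using hi
      · right; right; right; simpa using hi⟩

lemma psi_mid (F : PathFun X A) (G : C(ℝ × ℝ × ℝ, UnreducedSuspension X)) {x0 : X}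
    (γ : Path x0 x0) (t0 : I)
    (hG0 : ∀ s ∈ Icc (0:ℝ) 1, ∀ t ∈ Icc (0:ℝ) 1, G (s, t, 0) = ff γ t0 (s, t)) :
    psi F G (1/4, 1/2, 0) (3/4, 1/2, 0) = F.Φ γ.toContinuousMap := by
  have hval : ∀ t : I, G (AffineMap.lineMap ((1/4, 1/2, 0) : ℝ × ℝ × ℝ) (3/4, 1/2, 0) (t : ℝ))
      = qm (γ t) ⟨1/2, by norm_num, by norm_num⟩ := by
    intro t
    have h0 := t.2.1
    have h1 := t.2.2
    have e : (AffineMap.lineMap ((1/4, 1/2, 0) : ℝ × ℝ × ℝ) (3/4, 1/2, 0) (t : ℝ))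
        = (1/4 + (t:ℝ)/2, 1/2, 0) := by
      rw [AffineMap.lineMap_apply_module]
      ext
      · simp; ring
      · simp; ring
      · simp
    rw [e, hG0 _ ⟨by linarith, by linarith⟩ _ ⟨by norm_num, by norm_num⟩,
      ff_inner γ t0 (by linarith) (by linarith) (by norm_num) (by norm_num)]
    have e1 : 2 * (1/4 + (t:ℝ)/2) - 1/2 = t := by ring
    have e2 : 2 * (1/2 : ℝ) - 1/2 = 1/2 := by norm_num
    rw [e1, e2, projIcc_val, projIcc_of_mem _ (⟨by norm_num, by norm_num⟩ : (1/2 : ℝ) ∈ Icc (0:ℝ) 1)]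
  have n0 : (⟨1/2, by norm_num, by norm_num⟩ : I) ≠ 0 := by
    intro h; have := congrArg Subtype.val h; norm_num at this
  have n1 : (⟨1/2, by norm_num, by norm_num⟩ : I) ≠ 1 := by
    intro h; have := congrArg Subtype.val h; norm_num at this
  have hfun : (fun t : I => pr (G (AffineMap.lineMap ((1/4, 1/2, 0) : ℝ × ℝ × ℝ)
      (3/4, 1/2, 0) (t : ℝ)))) = γ := by
    funext t
    rw [hval, pr_qm _ _ n0 n1]
  have h : Continuous (fun t : I => pr (G (AffineMap.lineMap ((1/4, 1/2, 0) : ℝ × ℝ × ℝ)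
      (3/4, 1/2, 0) (t : ℝ)))) ∧
      ∀ t : I, G (AffineMap.lineMap ((1/4, 1/2, 0) : ℝ × ℝ × ℝ) (3/4, 1/2, 0) (t : ℝ)) ∈ W := by
    refine ⟨?_, fun t => ?_⟩
    · rw [hfun]; exact γ.continuous
    · rw [hval]; exact ⟨n0, n1⟩
  rw [psi, dif_pos h]
  congr 1
  ext t
  exact congrFun hfun t

/-- grid point -/
def PP (N i j k : ℕ) : ℝ × ℝ × ℝ := ((i:ℝ) / N, (j:ℝ) / N, (k:ℝ) / N)

lemma PP_ball {N : ℕ} {δ : ℝ} (hN : 0 < N) (hδ : 1 / (N:ℝ) < δ) (i j k : ℕ) {i' j' k' : ℕ}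
    (hi : i' = i ∨ i' = i + 1) (hj : j' = j ∨ j' = j + 1) (hk : k' = k ∨ k' = k + 1) :
    PP N i' j' k' ∈ Metric.ball (PP N i j k) δ := by
  have hN' : (0:ℝ) < N := by exact_mod_cast hN
  have h0 : 0 < 1 / (N:ℝ) := by positivity
  have key : ∀ {a b : ℕ}, (b = a ∨ b = a + 1) → dist ((b:ℝ) / N) ((a:ℝ) / N) < δ := by
    rintro a b (rfl | rfl)
    · simp; linarith
    · rw [Real.dist_eq]
      have : ((a + 1 : ℕ) : ℝ) / N - a / N = 1 / N := by push_cast; ring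
      rw [this, abs_of_pos h0]; exact hδ
  rw [Metric.mem_ball, PP, PP, Prod.dist_eq, Prod.dist_eq]
  exact max_lt (key hi) (max_lt (key hj) (key hk))

lemma main_calc (F : PathFun X A) (G : C(ℝ × ℝ × ℝ, UnreducedSuspension X)) {x0 : X}
    (γ : Path x0 x0) (t0 : I)
    (hG0 : ∀ s ∈ Icc (0:ℝ) 1, ∀ t ∈ Icc (0:ℝ) 1, G (s, t, 0) = ff γ t0 (s, t))
    (hGs : ∀ s t r : ℝ, (s = 0 ∨ s = 1 ∨ t = 0 ∨ t = 1) → G (s, t, r) = qm x0 t0)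
    (hG1 : ∀ s t : ℝ, G (s, t, 1) = qm x0 t0) :
    F.Φ γ.toContinuousMap = 0 := by
  -- Lebesgue number
  obtain ⟨δ, hδ, hL⟩ := lebesgue_number_lemma_of_metric (s := Icc (0 : ℝ × ℝ × ℝ) 1)
    (c := fun b : Bool => G ⁻¹' (ht ⁻¹' {if b then 1 else 0}ᶜ)) isCompact_Icc
    (fun b => (isOpen_compl_singleton.preimage continuous_ht).preimage G.continuous) (by
      intro z _
      rw [mem_iUnion]
      by_cases h : ht (G z) = 1
      · refine ⟨false, ?_⟩
        simp [h]
      · refine ⟨true, ?_⟩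
        simpa using h)
  obtain ⟨n, hn⟩ := exists_nat_one_div_lt hδ
  obtain ⟨M, hM⟩ : ∃ M : ℕ, M = n + 1 := ⟨_, rfl⟩
  have hM0 : 0 < M := by omega
  have hMr : (0:ℝ) < M := by exact_mod_cast hM0
  obtain ⟨N, hN⟩ : ∃ N : ℕ, N = 4 * M := ⟨_, rfl⟩
  have hN0 : 0 < N := by omega
  have hNr : (0:ℝ) < N := by exact_mod_cast hN0
  have hNM : (N:ℝ) = 4 * M := by rw [hN]; push_cast; ring
  have hNδ : 1 / (N:ℝ) < δ := by
    refine lt_of_le_of_lt ?_ hn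
    apply one_div_le_one_div_of_le (by positivity)
    rw [hNM, hM]; push_cast
    have : (0:ℝ) ≤ n := by positivity
    linarith
  have hNN : (N:ℝ) / N = 1 := div_self hNr.ne'
  have hle1 : ∀ {i : ℕ}, i ≤ N → (i:ℝ) / N ≤ 1 := by
    intro i hi
    rw [div_le_one hNr]
    exact_mod_cast hi
  have hge0 : ∀ (i : ℕ), 0 ≤ (i:ℝ) / N := fun i => by positivity
  -- big telescoping
  have hsum := telescope N
    (fun i j k => cc F G (PP N i j k) (PP N (i+1) j k) (PP N i (j+1) k) (PP N (i+1) (j+1) k))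
    (fun i j k => cc F G (PP N i j k) (PP N (i+1) j k) (PP N i j (k+1)) (PP N (i+1) j (k+1)))
    (fun i j k => cc F G (PP N i j k) (PP N i (j+1) k) (PP N i j (k+1)) (PP N i (j+1) (k+1)))
    (by
      intro i hi j hj k hk
      obtain ⟨b, hb⟩ := hL (PP N i j k)
        ⟨⟨hge0 _, hge0 _, hge0 _⟩, ⟨hle1 hi.le, hle1 hj.le, hle1 hk.le⟩⟩
      refine cc_cocycle F G (convex_ball (PP N i j k) δ) (by
        cases b
        · right
          intro z hz
          simpa using hb hz
        · left
          intro z hz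
          simpa using hb hz)
        (PP_ball hN0 hNδ i j k ?_ ?_ ?_) (PP_ball hN0 hNδ i j k ?_ ?_ ?_)
        (PP_ball hN0 hNδ i j k ?_ ?_ ?_) (PP_ball hN0 hNδ i j k ?_ ?_ ?_)
        (PP_ball hN0 hNδ i j k ?_ ?_ ?_) (PP_ball hN0 hNδ i j k ?_ ?_ ?_)
        (PP_ball hN0 hNδ i j k ?_ ?_ ?_) (PP_ball hN0 hNδ i j k ?_ ?_ ?_)
      all_goals first | exact Or.inl rfl | exact Or.inr rfl)
    (by
      intro i hi j hj
      refine cc_zero F G (S := univ ×ˢ univ ×ˢ {1})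
        (convex_univ.prod (convex_univ.prod (convex_singleton _))) x0 ?_ ?_ ?_ ?_ ?_
      · rintro ⟨s, t, r⟩ ⟨-, -, hr⟩
        obtain rfl : r = 1 := hr
        exact ⟨t0, hG1 s t⟩
      all_goals exact ⟨trivial, trivial, hNN⟩)
    (by
      intro i hi k hk
      refine cc_zero F G (S := univ ×ˢ {0} ×ˢ univ)
        (convex_univ.prod ((convex_singleton _).prod convex_univ)) x0 ?_ ?_ ?_ ?_ ?_
      · rintro ⟨s, t, r⟩ ⟨-, ht, -⟩
        exact ⟨t0, hGs s t r (Or.inr (Or.inr (Or.inl ht)))⟩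
      all_goals exact ⟨trivial, by simp [PP], trivial⟩)
    (by
      intro i hi k hk
      refine cc_zero F G (S := univ ×ˢ {1} ×ˢ univ)
        (convex_univ.prod ((convex_singleton _).prod convex_univ)) x0 ?_ ?_ ?_ ?_ ?_
      · rintro ⟨s, t, r⟩ ⟨-, ht, -⟩
        exact ⟨t0, hGs s t r (Or.inr (Or.inr (Or.inr ht)))⟩
      all_goals exact ⟨trivial, hNN, trivial⟩)
    (by
      intro i hi k hk
      refine cc_zero F G (S := {0} ×ˢ univ ×ˢ univ)
        ((convex_singleton _).prod (convex_univ.prod convex_univ)) x0 ?_ ?_ ?_ ?_ ?_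
      · rintro ⟨s, t, r⟩ ⟨hs, -, -⟩
        exact ⟨t0, hGs s t r (Or.inl hs)⟩
      all_goals exact ⟨by simp [PP], trivial, trivial⟩)
    (by
      intro i hi k hk
      refine cc_zero F G (S := {1} ×ˢ univ ×ˢ univ)
        ((convex_singleton _).prod (convex_univ.prod convex_univ)) x0 ?_ ?_ ?_ ?_ ?_
      · rintro ⟨s, t, r⟩ ⟨hs, -, -⟩
        exact ⟨t0, hGs s t r (Or.inr (Or.inl hs))⟩
      all_goals exact ⟨hNN, trivial, trivial⟩)
  -- evaluation on the bottom face
  let box : ℕ → ℕ → Set (ℝ × ℝ × ℝ) := fun i j =>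
    Icc ((i:ℝ) / N) (((i + 1 : ℕ) : ℝ) / N) ×ˢ Icc ((j:ℝ) / N) (((j + 1 : ℕ) : ℝ) / N) ×ˢ {0}
  have hbox : ∀ i j, Convex ℝ (box i j) := fun i j =>
    (convex_Icc _ _).prod ((convex_Icc _ _).prod (convex_singleton _))
  have hlt : ∀ i : ℕ, (i:ℝ) / N ≤ ((i + 1 : ℕ) : ℝ) / N := by
    intro i
    gcongr
    simp
  have hmem : ∀ i j, ∀ {i' j' : ℕ}, (i' = i ∨ i' = i + 1) → (j' = j ∨ j' = j + 1) →
      PP N i' j' 0 ∈ box i j := by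
    intro i j i' j' hi hj
    refine ⟨?_, ?_, by simp [PP]⟩
    · rcases hi with rfl | rfl
      · exact ⟨le_rfl, hlt _⟩
      · exact ⟨hlt _, le_rfl⟩
    · rcases hj with rfl | rfl
      · exact ⟨le_rfl, hlt _⟩
      · exact ⟨hlt _, le_rfl⟩
  -- comparison helpers
  have hup : ∀ {a q : ℕ}, a ≤ q * M → (a:ℝ) / N ≤ q / 4 := by
    intro a q h
    rw [div_le_iff₀ hNr, hNM]
    have : (a:ℝ) ≤ q * M := by exact_mod_cast h
    linarith
  have hdn : ∀ {a q : ℕ}, q * M ≤ a → (q:ℝ) / 4 ≤ (a:ℝ) / N := by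
    intro a q h
    rw [le_div_iff₀ hNr, hNM]
    have : (q:ℝ) * M ≤ a := by exact_mod_cast h
    linarith
  have hboxG : ∀ i < N, ∀ j < N, ∀ z ∈ box i j, G z = ff γ t0 (z.1, z.2.1) := by
    rintro i hi j hj ⟨s, t, r⟩ ⟨hs, ht, hr⟩
    obtain rfl : r = 0 := hr
    exact hG0 s ⟨(hge0 i).trans hs.1, hs.2.trans (hle1 hi)⟩ t
      ⟨(hge0 j).trans ht.1, ht.2.trans (hle1 hj)⟩
  have houter : ∀ i < N, ∀ j < N, (i < M ∨ 3 * M ≤ i ∨ j < M ∨ 3 * M ≤ j) →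
      ∀ z ∈ box i j, ∃ w, G z = qm x0 w := by
    intro i hi j hj h z hz
    rw [hboxG i hi j hj z hz]
    refine ⟨_, ff_outer γ t0 ?_⟩
    obtain ⟨hs, ht, -⟩ := hz
    rcases h with h | h | h | h
    · left
      have := hup (a := i + 1) (q := 1) (by omega)
      exact hs.2.trans (by simpa using this)
    · right; left
      have := hdn (a := i) (q := 3) h
      exact le_trans (by simpa using this) hs.1
    · right; right; left
      have := hup (a := j + 1) (q := 1) (by omega)
      exact ht.2.trans (by simpa using this)
    · right; right; right
      have := hdn (a := j) (q := 3) h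
      exact le_trans (by simpa using this) ht.1
  have hinner : ∀ i < N, ∀ j < N, ¬ (i < M ∨ 3 * M ≤ i ∨ j < M ∨ 3 * M ≤ j) →
      ∀ z ∈ box i j, ht (G z) = projIcc 0 1 zero_le_one (2 * z.2.1 - 1/2) := by
    intro i hi j hj h z hz
    rw [hboxG i hi j hj z hz]
    obtain ⟨hs, ht, -⟩ := hz
    have a1 := hdn (a := i) (q := 1) (by omega)
    have a2 := hup (a := i + 1) (q := 3) (by omega)
    have a3 := hdn (a := j) (q := 1) (by omega)
    have a4 := hup (a := j + 1) (q := 3) (by omega)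
    rw [ff_inner γ t0 (le_trans (by simpa using a1) hs.1) (hs.2.trans (by simpa using a2))
      (le_trans (by simpa using a3) ht.1) (ht.2.trans (by simpa using a4)), ht_qm]
  have hlow : ∀ i < N, ∀ j < 2 * M,
      cc F G (PP N i j 0) (PP N (i+1) j 0) (PP N i (j+1) 0) (PP N (i+1) (j+1) 0) = 0 := by
    intro i hi j hj
    have hjN : j < N := by omega
    by_cases h : (i < M ∨ 3 * M ≤ i ∨ j < M ∨ 3 * M ≤ j)
    · exact cc_zero F G (hbox i j) x0 (houter i hi j hjN h) (hmem i j (.inl rfl) (.inl rfl))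
        (hmem i j (.inr rfl) (.inl rfl)) (hmem i j (.inl rfl) (.inr rfl))
        (hmem i j (.inr rfl) (.inr rfl))
    · refine cc_U F G (hbox i j) ?_ (hmem i j (.inl rfl) (.inl rfl))
        (hmem i j (.inr rfl) (.inl rfl)) (hmem i j (.inl rfl) (.inr rfl))
        (hmem i j (.inr rfl) (.inr rfl))
      intro z hz
      rw [hinner i hi j hjN h z hz]
      have h2 : z.2.1 ≤ 1/2 := by
        have := hup (a := j + 1) (q := 2) (by omega)
        exact (hz.2.1.2.trans this).trans (by norm_num)
      intro h3
      have h4 := (projIcc_eq_right (zero_lt_one' ℝ)).mp h3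
      linarith
  have hhigh : ∀ i < N, ∀ j < N, 2 * M ≤ j →
      cc F G (PP N i j 0) (PP N (i+1) j 0) (PP N i (j+1) 0) (PP N (i+1) (j+1) 0) =
      circ F G (PP N i j 0) (PP N (i+1) j 0) (PP N i (j+1) 0) (PP N (i+1) (j+1) 0) := by
    intro i hi j hjN hj
    by_cases h : (i < M ∨ 3 * M ≤ i ∨ j < M ∨ 3 * M ≤ j)
    · rw [cc_zero F G (hbox i j) x0 (houter i hi j hjN h) (hmem i j (.inl rfl) (.inl rfl))
        (hmem i j (.inr rfl) (.inl rfl)) (hmem i j (.inl rfl) (.inr rfl))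
        (hmem i j (.inr rfl) (.inr rfl)),
        circ_zero F G (hbox i j) x0 (houter i hi j hjN h) (hmem i j (.inl rfl) (.inl rfl))
        (hmem i j (.inr rfl) (.inl rfl)) (hmem i j (.inl rfl) (.inr rfl))
        (hmem i j (.inr rfl) (.inr rfl))]
    · refine cc_V F G (hbox i j) ?_ (hmem i j (.inl rfl) (.inl rfl))
        (hmem i j (.inr rfl) (.inl rfl)) (hmem i j (.inl rfl) (.inr rfl))
        (hmem i j (.inr rfl) (.inr rfl))
      intro z hz
      rw [hinner i hi j hjN h z hz]
      have h2 : 1/2 ≤ z.2.1 := by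
        have := hdn (a := j) (q := 2) (by omega)
        exact le_trans (by norm_num) (this.trans hz.2.1.1)
      intro h3
      have h4 := (projIcc_eq_left (zero_lt_one' ℝ)).mp h3
      linarith
  -- edges
  let eh : ℕ → ℕ → A := fun i j => psi F G (PP N i j 0) (PP N (i+1) j 0)
  let ev : ℕ → ℕ → A := fun i j => psi F G (PP N i j 0) (PP N i (j+1) 0)
  have hev0 : ∀ j, ev 0 j = 0 := fun j => psi_zero F G (S := {0} ×ˢ univ ×ˢ univ)
    ((convex_singleton _).prod (convex_univ.prod convex_univ)) x0
    (by
      rintro ⟨s, t, r⟩ ⟨hs, -, -⟩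
      exact ⟨t0, hGs s t r (Or.inl hs)⟩)
    ⟨by simp [PP], trivial, trivial⟩ ⟨by simp [PP], trivial, trivial⟩
  have hevN : ∀ j, ev N j = 0 := fun j => psi_zero F G (S := {1} ×ˢ univ ×ˢ univ)
    ((convex_singleton _).prod (convex_univ.prod convex_univ)) x0
    (by
      rintro ⟨s, t, r⟩ ⟨hs, -, -⟩
      exact ⟨t0, hGs s t r (Or.inr (Or.inl hs))⟩)
    ⟨hNN, trivial, trivial⟩ ⟨hNN, trivial, trivial⟩
  have hehN : ∀ i, eh i N = 0 := fun i => psi_zero F G (S := univ ×ˢ {1} ×ˢ univ)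
    (convex_univ.prod ((convex_singleton _).prod convex_univ)) x0
    (by
      rintro ⟨s, t, r⟩ ⟨-, ht, -⟩
      exact ⟨t0, hGs s t r (Or.inr (Or.inr (Or.inr ht)))⟩)
    ⟨trivial, hNN, trivial⟩ ⟨trivial, hNN, trivial⟩
  have hcol : ∀ i ∈ Finset.range N, ∑ j ∈ Finset.range N,
      cc F G (PP N i j 0) (PP N (i+1) j 0) (PP N i (j+1) 0) (PP N (i+1) (j+1) 0)
      = eh i (2 * M) + ((∑ j ∈ Finset.range (2 * M), ev (i + 1) (2 * M + j))
        - ∑ j ∈ Finset.range (2 * M), ev i (2 * M + j)) := by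
    intro i hi
    rw [Finset.mem_range] at hi
    have e1 : Finset.range N = Finset.range (2 * M + 2 * M) := by congr 1; omega
    rw [e1, Finset.sum_range_add, Finset.sum_eq_zero (s := Finset.range (2 * M))
      (fun j hj => hlow i hi j (Finset.mem_range.mp hj)), zero_add]
    have e2 : ∀ j ∈ Finset.range (2 * M), cc F G (PP N i (2*M+j) 0) (PP N (i+1) (2*M+j) 0)
        (PP N i (2*M+j+1) 0) (PP N (i+1) (2*M+j+1) 0)
        = (ev (i+1) (2*M+j) - ev i (2*M+j)) - (eh i (2*M+(j+1)) - eh i (2*M+j)) := by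
      intro j hj
      rw [Finset.mem_range] at hj
      rw [hhigh i hi (2*M+j) (by omega) (by omega), circ]
      simp only [ev, eh, add_assoc]
      abel
    rw [Finset.sum_congr rfl e2, Finset.sum_sub_distrib,
      Finset.sum_range_sub (fun j => eh i (2*M+j)), Finset.sum_sub_distrib]
    have e3 : eh i (2*M+2*M) = 0 := by
      have : 2*M+2*M = N := by omega
      rw [this]; exact hehN i
    rw [e3, add_zero]
    abel
  rw [Finset.sum_congr rfl hcol, Finset.sum_add_distrib,
    Finset.sum_range_sub (fun i => ∑ j ∈ Finset.range (2 * M), ev i (2 * M + j))] at hsum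
  simp only [hev0, hevN, Finset.sum_const_zero, sub_zero, add_zero] at hsum
  -- the row
  have e4 : Finset.range N = Finset.range (M + 2 * M + M) := by congr 1; omega
  have hrow0 : ∀ i < N, (i < M ∨ 3 * M ≤ i) → eh i (2 * M) = 0 := by
    intro i hi h
    exact psi_zero F G (hbox i (2*M)) x0 (houter i hi (2*M) (by omega) (by omega))
      (hmem i _ (.inl rfl) (.inl rfl)) (hmem i _ (.inr rfl) (.inl rfl))
  rw [e4, Finset.sum_range_add, Finset.sum_range_add,
    Finset.sum_eq_zero (s := Finset.range M) (f := fun i => eh i (2*M))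
      (fun i hi => hrow0 i (by have := Finset.mem_range.mp hi; omega)
        (.inl (Finset.mem_range.mp hi))),
    Finset.sum_eq_zero (s := Finset.range M) (f := fun i => eh (M + 2*M + i) (2*M))
      (fun i hi => hrow0 _ (by have := Finset.mem_range.mp hi; omega) (.inr (by omega))),
    zero_add, add_zero] at hsum
  have hmidS : Convex ℝ (Icc (1/4:ℝ) (3/4) ×ˢ ({1/2} : Set ℝ) ×ˢ ({0} : Set ℝ)) :=
    (convex_Icc _ _).prod ((convex_singleton _).prod (convex_singleton _))
  have hhalf : ((2 * M : ℕ) : ℝ) / N = 1/2 := by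
    rw [hNM]; push_cast; field_simp; norm_num
  have hmidmem : ∀ i, M ≤ i → i ≤ 3 * M →
      PP N i (2*M) 0 ∈ (Icc (1/4:ℝ) (3/4) ×ˢ ({1/2} : Set ℝ) ×ˢ ({0} : Set ℝ)) := by
    intro i h1 h2
    refine ⟨⟨?_, ?_⟩, hhalf, by simp [PP]⟩
    · simpa [PP] using hdn (a := i) (q := 1) (by omega)
    · simpa [PP] using hup (a := i) (q := 3) h2
  have hmidW : ∀ z ∈ (Icc (1/4:ℝ) (3/4) ×ˢ ({1/2} : Set ℝ) ×ˢ ({0} : Set ℝ)), G z ∈ W := by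
    rintro ⟨s, t, r⟩ ⟨hs, ht, hr⟩
    obtain rfl : t = 1/2 := ht
    obtain rfl : r = 0 := hr
    have hs1 : 1/4 ≤ s := hs.1
    have hs2 : s ≤ 3/4 := hs.2
    rw [hG0 s ⟨by linarith, by linarith⟩ _ ⟨by norm_num, by norm_num⟩,
      ff_inner γ t0 hs1 hs2 (by norm_num) (by norm_num)]
    constructor
    · rw [ht_qm]
      intro h3
      have h4 := (projIcc_eq_left (zero_lt_one' ℝ)).mp h3
      norm_num at h4
    · rw [ht_qm]
      intro h3
      have h4 := (projIcc_eq_right (zero_lt_one' ℝ)).mp h3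
      norm_num at h4
  have hmid : ∀ m ≤ 2 * M, ∑ i ∈ Finset.range m, eh (M + i) (2 * M)
      = psi F G (PP N M (2*M) 0) (PP N (M + m) (2*M) 0) := by
    intro m
    induction m with
    | zero =>
      intro _
      have hm := hmidmem M le_rfl (by omega)
      have := psi_add F G hmidS hmidW hm hm hm
      have h0 := add_eq_left.mp this
      simpa using h0.symm
    | succ m ih =>
      intro hm
      rw [Finset.sum_range_succ, ih (by omega)]
      exact psi_add F G hmidS hmidW (hmidmem M le_rfl (by omega))
        (hmidmem (M + m) (by omega) (by omega)) (hmidmem (M + m + 1) (by omega) (by omega))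
  rw [hmid _ le_rfl] at hsum
  have p1 : PP N M (2*M) 0 = (1/4, 1/2, 0) := by
    unfold PP
    rw [hhalf, hNM]
    ext
    · field_simp
    · rfl
    · simp
  have p2 : PP N (M + 2*M) (2*M) 0 = (3/4, 1/2, 0) := by
    unfold PP
    rw [hhalf, hNM]
    ext
    · push_cast; field_simp; norm_num
    · rfl
    · simp
  rw [p1, p2, psi_mid F G γ t0 hG0] at hsum
  exact hsum

lemma final (x0 : X) (t0 : I) (F : PathFun X A) (γ : Path x0 x0)
    (h : GenLoop.Homotopic (gl γ t0) GenLoop.const) : F.Φ γ.toContinuousMap = 0 := by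
  obtain ⟨H⟩ := h
  let p : ℝ → I := projIcc 0 1 zero_le_one
  have hp : Continuous p := continuous_projIcc
  have p0 : p 0 = 0 := projIcc_left _
  have p1 : p 1 = 1 := projIcc_right _
  let G : C(ℝ × ℝ × ℝ, UnreducedSuspension X) :=
    ⟨fun z => H (p z.2.2, ![p z.1, p z.2.1]), by
      refine H.continuous.comp (Continuous.prodMk (by fun_prop) ?_)
      refine continuous_pi fun i => ?_
      fin_cases i
      · exact hp.comp continuous_fst
      · exact hp.comp (continuous_fst.comp continuous_snd)⟩
  refine main_calc F G γ t0 ?_ ?_ ?_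
  · intro s hs t ht
    change H (p 0, ![p s, p t]) = _
    rw [p0, H.apply_zero]
    change ff γ t0 ((p s : ℝ), (p t : ℝ)) = _
    simp only [p, projIcc_of_mem _ hs, projIcc_of_mem _ ht]
  · intro s t r h
    change H (p r, ![p s, p t]) = _
    have hb : (![p s, p t] : Fin 2 → I) ∈ Cube.boundary (Fin 2) := by
      rcases h with rfl | rfl | rfl | rfl
      · exact ⟨0, Or.inl p0⟩
      · exact ⟨0, Or.inr p1⟩
      · exact ⟨1, Or.inl p0⟩
      · exact ⟨1, Or.inr p1⟩
    rw [H.eq_fst _ hb]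
    exact (gl γ t0).2 _ hb
  · intro s t
    change H (p 1, ![p s, p t]) = _
    rw [p1, H.apply_one]
    rfl

end SuspPi2

end

/-- If `X` is a nonempty path-connected topological space whose fundamental group is not a
perfect group (it is not equal to its own commutator subgroup), then the second homotopy
group of the unreduced suspension of `X` is nontrivial. -/
theorem suspension_pi2_nontrivial (X : Type) [TopologicalSpace X] [Nonempty X]
    [PathConnectedSpace X] (x : X)
    (hx : commutator (FundamentalGroup X x) ≠ ⊤) :
    ∀ y : UnreducedSuspension X,
      Nontrivial (HomotopyGroup (Fin 2) (UnreducedSuspension X) y) := by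

  intro y
  obtain ⟨⟨x0, t0⟩, rfl⟩ := Quotient.exists_rep y
  obtain ⟨A, _, F, γ, hγ⟩ := SuspPi2.exists_pathFun x hx x0
  refine ⟨Quotient.mk _ (SuspPi2.gl γ t0), Quotient.mk _ GenLoop.const, fun h => hγ ?_⟩
  exact SuspPi2.final x0 t0 F γ (Quotient.exact h)
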